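/- With the discrete Fourier setup and the coefficients A_{pq}^{rs} defined from the symmetric kernel modes B̂, the Fourier collocation collision term Q^C_r = Σ_{l,m∈K} (B̂(l,m) − B̂(m,m)) F̂_l F̂_m ω^{(l+m)·r} satisfies, for every F : K → ℂ and every r ∈ K, the discrete-velocity-method form Q^C_r = Σ_{p,q,s∈K} A_{pq}^{rs} (F_p F_q − F_r F_s). -/

import Mathlib

open scoped BigOperators

noncomputable section

/-- The finite set of Fourier modes `K = {k ∈ ℤ^d : |k_i| ≤ n}`. -/
def K (d n : ℕ) : Finset (Fin d → ℤ) := Fintype.piFinset fun _ => Finset.Icc (-(n : ℤ)) n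

/-- Integer dot product on `ℤ^d`. -/
def dotZ {d : ℕ} (k p : Fin d → ℤ) : ℤ := ∑ i, k i * p i

/-- The root of unity power `ω^a = exp(2πi a / N)`. -/
def ω (N : ℕ) (a : ℤ) : ℂ := Complex.exp (2 * Real.pi * Complex.I * a / N)

/-- The indicator `1_N(l)`, equal to `1` if `l ≡ 0 (mod N)` componentwise and `0` otherwise. -/
def indN (N : ℕ) {d : ℕ} (l : Fin d → ℤ) : ℂ := if ∀ i, (N : ℤ) ∣ l i then 1 else 0

/-- The symmetric modulo map: the unique element of `K d n` congruent to `l` modulo `N = 2n+1`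
componentwise. -/
def smod (n : ℕ) {d : ℕ} (l : Fin d → ℤ) : Fin d → ℤ :=
  fun i => (l i + n) % (2 * n + 1) - n

/-- Discrete Fourier coefficients `F̂_k = N^{-d} Σ_{p ∈ K} F_p ω^{-k·p}`. -/
def Fhat (d n : ℕ) (F : (Fin d → ℤ) → ℂ) (k : Fin d → ℤ) : ℂ :=
  ((2 * n + 1 : ℂ) ^ d)⁻¹ * ∑ p ∈ K d n, F p * ω (2 * n + 1) (-(dotZ k p))

/-- The discrete-velocity-method coefficients `A_{pq}^{rs}` obtained from the kernel modes `B̂`. -/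
def Acoef (d n : ℕ) (Bh : (Fin d → ℤ) → (Fin d → ℤ) → ℂ) (p q r s : Fin d → ℤ) : ℂ :=
  ((2 * n + 1 : ℂ) ^ (3 * d))⁻¹ *
    ∑ l ∈ K d n, ∑ m ∈ K d n, ∑ k ∈ K d n, ∑ j ∈ K d n,
      indN (2 * n + 1) (l + m - k - j) * Bh (smod n (l - j)) (smod n (m - j)) *
        ω (2 * n + 1) (-(dotZ l p)) * ω (2 * n + 1) (-(dotZ m q)) *
        ω (2 * n + 1) (dotZ k r) * ω (2 * n + 1) (dotZ j s)

theorem ω_add (N : ℕ) (a b : ℤ) : ω N (a + b) = ω N a * ω N b := by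
  simp only [ω, ← Complex.exp_add]
  congr 1
  push_cast
  ring

theorem ω_eq_zpow (N : ℕ) (a : ℤ) : ω N a = Complex.exp (2 * Real.pi * Complex.I / N) ^ a := by
  rw [ω, ← Complex.exp_int_mul]
  congr 1
  ring

theorem ω_eq_one_iff {N : ℕ} (hN : N ≠ 0) (a : ℤ) : ω N a = 1 ↔ (N : ℤ) ∣ a := by
  rw [ω_eq_zpow]
  exact (Complex.isPrimitiveRoot_exp N hN).zpow_eq_one_iff_dvd a

theorem ω_zero (N : ℕ) : ω N 0 = 1 := by simp [ω]

theorem ω_congr {N : ℕ} (hN : N ≠ 0) {a b : ℤ} (h : (N : ℤ) ∣ a - b) : ω N a = ω N b := by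
  rw [← sub_add_cancel a b, ω_add, (ω_eq_one_iff hN _).2 h, one_mul]

theorem ω_sum {ι : Type*} (N : ℕ) (s : Finset ι) (f : ι → ℤ) :
    ω N (∑ i ∈ s, f i) = ∏ i ∈ s, ω N (f i) := by
  classical
  induction s using Finset.induction_on with
  | empty => simp [ω_zero]
  | insert a s ha ih => rw [Finset.sum_insert ha, Finset.prod_insert ha, ω_add, ih]

theorem sum_Icc_ω_mul (n : ℕ) (a : ℤ) :
    ∑ s ∈ Finset.Icc (-(n : ℤ)) n, ω (2 * n + 1) (a * s) =
      if ((2 * n + 1 : ℕ) : ℤ) ∣ a then (2 * n + 1 : ℂ) else 0 := by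
  have hN : 2 * n + 1 ≠ 0 := by omega
  split_ifs with h
  · rw [Finset.sum_congr rfl fun s _ => (ω_eq_one_iff hN (a * s)).2 (h.mul_right s)]
    simp only [Finset.sum_const, Int.card_Icc, nsmul_eq_mul, mul_one]
    rw [show ((n : ℤ) + 1 - -(n : ℤ)).toNat = 2 * n + 1 by omega]
    push_cast
    ring
  · have hx : ω (2 * n + 1) a ≠ 1 := fun h1 => h ((ω_eq_one_iff hN a).1 h1)
    have hpow (i : ℕ) : ω (2 * n + 1) (a * i) = ω (2 * n + 1) a ^ i := by
      rw [ω_eq_zpow, ω_eq_zpow, zpow_mul, zpow_natCast]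
    have hsum : ∑ i ∈ Finset.range (2 * n + 1), ω (2 * n + 1) a ^ i = 0 := by
      rw [geom_sum_eq hx, ← hpow, (ω_eq_one_iff hN _).2 (dvd_mul_left _ _), sub_self, zero_div]
    have hshift : ∑ s ∈ Finset.Icc (-(n : ℤ)) n, ω (2 * n + 1) (a * s) =
        ∑ i ∈ Finset.range (2 * n + 1), ω (2 * n + 1) (a * -n) * ω (2 * n + 1) a ^ i := by
      symm
      refine Finset.sum_bij (fun i _ => (i : ℤ) - n) ?_ ?_ ?_ ?_
      · intro i hi
        simp only [Finset.mem_range, Finset.mem_Icc] at *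
        omega
      · intro i _ j _ hij
        omega
      · intro s hs
        simp only [Finset.mem_Icc] at hs
        exact ⟨(s + n).toNat, by simp only [Finset.mem_range]; omega, by omega⟩
      · intro i _
        rw [← hpow, ← ω_add]
        congr 1
        ring
    rw [hshift, ← Finset.mul_sum, hsum, mul_zero]

theorem mem_K {d n : ℕ} {k : Fin d → ℤ} : k ∈ K d n ↔ ∀ i, -(n : ℤ) ≤ k i ∧ k i ≤ n := by
  simp [K, Fintype.mem_piFinset]

theorem zero_mem_K (d n : ℕ) : (0 : Fin d → ℤ) ∈ K d n := by
  simp [mem_K]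

theorem neg_mem_K {d n : ℕ} {k : Fin d → ℤ} (hk : k ∈ K d n) : -k ∈ K d n := by
  rw [mem_K] at *
  intro i
  have := hk i
  simp only [Pi.neg_apply]
  omega

theorem eq_of_mem_K {d n : ℕ} {k l : Fin d → ℤ} (hk : k ∈ K d n) (hl : l ∈ K d n)
    (h : ∀ i, ((2 * n + 1 : ℕ) : ℤ) ∣ (k - l) i) : k = l := by
  rw [mem_K] at *
  ext i
  have h1 := hk i
  have h2 := hl i
  have h3 : (k - l) i = 0 := by
    apply Int.eq_zero_of_abs_lt_dvd (h i)
    rw [Pi.sub_apply, abs_lt]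
    omega
  rw [Pi.sub_apply] at h3
  omega

theorem smod_mem_K {d : ℕ} (n : ℕ) (l : Fin d → ℤ) : smod n l ∈ K d n := by
  rw [mem_K]
  intro i
  have h1 := Int.emod_nonneg (l i + n) (b := 2 * n + 1) (by omega)
  have h2 := Int.emod_lt_of_pos (l i + n) (b := 2 * n + 1) (by omega)
  simp only [smod]
  omega

theorem dvd_sub_smod {d : ℕ} (n : ℕ) (l : Fin d → ℤ) (i : Fin d) :
    ((2 * n + 1 : ℕ) : ℤ) ∣ (l - smod n l) i := by
  refine ⟨(l i + n) / (2 * n + 1), ?_⟩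
  have h := Int.mul_ediv_add_emod (l i + n) (2 * n + 1)
  simp only [Pi.sub_apply, smod]
  push_cast
  linarith

theorem smod_eq_self {d n : ℕ} {l : Fin d → ℤ} (hl : l ∈ K d n) : smod n l = l :=
  (eq_of_mem_K hl (smod_mem_K n l) (dvd_sub_smod n l)).symm

theorem dotZ_comm {d : ℕ} (k p : Fin d → ℤ) : dotZ k p = dotZ p k := by
  simp only [dotZ, mul_comm]

theorem dotZ_add {d : ℕ} (k l p : Fin d → ℤ) : dotZ (k + l) p = dotZ k p + dotZ l p := by
  simp [dotZ, add_mul, Finset.sum_add_distrib]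

theorem dotZ_neg {d : ℕ} (k p : Fin d → ℤ) : dotZ (-k) p = -dotZ k p := by
  simp [dotZ]

theorem dotZ_sub {d : ℕ} (k l p : Fin d → ℤ) : dotZ (k - l) p = dotZ k p - dotZ l p := by
  rw [sub_eq_add_neg, dotZ_add, dotZ_neg, sub_eq_add_neg]

theorem zero_dotZ {d : ℕ} (p : Fin d → ℤ) : dotZ 0 p = 0 := by
  simp [dotZ]

theorem ω_dotZ_smod {d : ℕ} (n : ℕ) (l r : Fin d → ℤ) :
    ω (2 * n + 1) (dotZ (smod n l) r) = ω (2 * n + 1) (dotZ l r) := by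
  symm
  apply ω_congr (by omega)
  rw [← dotZ_sub]
  exact Finset.dvd_sum fun i _ => (dvd_sub_smod n l i).mul_right _

/-- Orthogonality of the discrete exponentials. -/
theorem sum_K_ω_dotZ {d : ℕ} (n : ℕ) (j : Fin d → ℤ) :
    ∑ s ∈ K d n, ω (2 * n + 1) (dotZ j s) = (2 * n + 1 : ℂ) ^ d * indN (2 * n + 1) j := by
  simp only [dotZ, ω_sum, K]
  rw [← Finset.prod_univ_sum (fun _ : Fin d => Finset.Icc (-(n : ℤ)) n)
    (fun i s => ω (2 * n + 1) (j i * s))]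
  simp only [sum_Icc_ω_mul, indN]
  split_ifs with h
  · simp only [h, if_true, Finset.prod_const, Finset.card_univ, Fintype.card_fin, mul_one]
  · push Not at h
    obtain ⟨i, hi⟩ := h
    rw [mul_zero]
    exact Finset.prod_eq_zero (Finset.mem_univ i) (if_neg hi)

theorem sum_K_ω_neg_dotZ {d : ℕ} (n : ℕ) (j : Fin d → ℤ) :
    ∑ s ∈ K d n, ω (2 * n + 1) (-dotZ j s) = (2 * n + 1 : ℂ) ^ d * indN (2 * n + 1) j := by
  simp only [← dotZ_neg, sum_K_ω_dotZ, indN, Pi.neg_apply, dvd_neg]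

theorem sum_K_indN_sub {d : ℕ} (n : ℕ) (v : Fin d → ℤ) (g : (Fin d → ℤ) → ℂ) :
    ∑ k ∈ K d n, indN (2 * n + 1) (v - k) * g k = g (smod n v) := by
  rw [Finset.sum_eq_single_of_mem (smod n v) (smod_mem_K n v)]
  · rw [indN, if_pos (dvd_sub_smod n v), one_mul]
  · intro k hk hne
    rw [indN, if_neg, zero_mul]
    intro h
    refine hne (eq_of_mem_K hk (smod_mem_K n v) fun i => ?_)
    rw [← sub_sub_sub_cancel_left (smod n v) k v]
    exact dvd_sub (dvd_sub_smod n v i) (h i)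

theorem sum_K_indN {d : ℕ} (n : ℕ) (g : (Fin d → ℤ) → ℂ) :
    ∑ k ∈ K d n, indN (2 * n + 1) k * g k = g 0 := by
  rw [Finset.sum_eq_single_of_mem 0 (zero_mem_K d n)]
  · simp [indN]
  · intro k hk hne
    rw [indN, if_neg, zero_mul]
    intro h
    exact hne (eq_of_mem_K hk (zero_mem_K d n) (by simpa using h))

theorem natCast_pow_ne_zero (d n : ℕ) : (2 * n + 1 : ℂ) ^ d ≠ 0 := by
  exact_mod_cast pow_ne_zero d (by omega : 2 * n + 1 ≠ 0)

/-- Fourier inversion. -/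
theorem sum_Fhat_mul_ω {d n : ℕ} (F : (Fin d → ℤ) → ℂ) {r : Fin d → ℤ} (hr : r ∈ K d n) :
    ∑ l ∈ K d n, Fhat d n F l * ω (2 * n + 1) (dotZ l r) = F r := by
  calc _ = ((2 * n + 1 : ℂ) ^ d)⁻¹ * ∑ p ∈ K d n, F p *
        ∑ l ∈ K d n, ω (2 * n + 1) (dotZ (r - p) l) := by
        simp only [Fhat, Finset.mul_sum, Finset.sum_mul]
        rw [Finset.sum_comm]
        refine Finset.sum_congr rfl fun p _ => Finset.sum_congr rfl fun l _ => ?_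
        rw [dotZ_sub, sub_eq_neg_add, ω_add, dotZ_comm p, dotZ_comm r]
        ring
    _ = ((2 * n + 1 : ℂ) ^ d)⁻¹ * ((2 * n + 1 : ℂ) ^ d *
        ∑ p ∈ K d n, indN (2 * n + 1) (r - p) * F p) := by
        simp only [sum_K_ω_dotZ, Finset.mul_sum]
        refine Finset.sum_congr rfl fun p _ => ?_
        ring
    _ = F r := by
        rw [sum_K_indN_sub, smod_eq_self hr, inv_mul_cancel_left₀ (natCast_pow_ne_zero d n)]

theorem sum_Acoef_right {d n : ℕ} (Bh : (Fin d → ℤ) → (Fin d → ℤ) → ℂ) (p q r : Fin d → ℤ) :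
    ∑ s ∈ K d n, Acoef d n Bh p q r s =
      ((2 * n + 1 : ℂ) ^ d)⁻¹ * ((2 * n + 1 : ℂ) ^ d)⁻¹ * ∑ l ∈ K d n, ∑ m ∈ K d n,
        Bh l m * ω (2 * n + 1) (-(dotZ l p)) * ω (2 * n + 1) (-(dotZ m q)) *
          ω (2 * n + 1) (dotZ (l + m) r) := by
  have hinner (l : Fin d → ℤ) (hl : l ∈ K d n) (m : Fin d → ℤ) (hm : m ∈ K d n) :
      ∑ s ∈ K d n, ∑ k ∈ K d n, ∑ j ∈ K d n,
        indN (2 * n + 1) (l + m - k - j) * Bh (smod n (l - j)) (smod n (m - j)) *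
          ω (2 * n + 1) (-(dotZ l p)) * ω (2 * n + 1) (-(dotZ m q)) *
          ω (2 * n + 1) (dotZ k r) * ω (2 * n + 1) (dotZ j s) =
      (2 * n + 1 : ℂ) ^ d * (Bh l m * ω (2 * n + 1) (-(dotZ l p)) *
        ω (2 * n + 1) (-(dotZ m q)) * ω (2 * n + 1) (dotZ (l + m) r)) := by
    rw [Finset.sum_comm]
    calc _ = ∑ k ∈ K d n, (2 * n + 1 : ℂ) ^ d * ∑ j ∈ K d n, indN (2 * n + 1) j *
          (indN (2 * n + 1) (l + m - k - j) * Bh (smod n (l - j)) (smod n (m - j)) *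
          ω (2 * n + 1) (-(dotZ l p)) * ω (2 * n + 1) (-(dotZ m q)) *
          ω (2 * n + 1) (dotZ k r)) := by
          refine Finset.sum_congr rfl fun k _ => ?_
          rw [Finset.sum_comm, Finset.mul_sum]
          refine Finset.sum_congr rfl fun j _ => ?_
          rw [← Finset.mul_sum, sum_K_ω_dotZ]
          ring
      _ = (2 * n + 1 : ℂ) ^ d * ∑ k ∈ K d n, indN (2 * n + 1) (l + m - k) * (Bh l m *
          ω (2 * n + 1) (-(dotZ l p)) * ω (2 * n + 1) (-(dotZ m q)) *
          ω (2 * n + 1) (dotZ k r)) := by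
          rw [← Finset.mul_sum]
          congr 1
          refine Finset.sum_congr rfl fun k _ => ?_
          rw [sum_K_indN, sub_zero, sub_zero, sub_zero, smod_eq_self hl, smod_eq_self hm]
          ring
      _ = _ := by rw [sum_K_indN_sub, ω_dotZ_smod]
  have hswap : ∑ s ∈ K d n, Acoef d n Bh p q r s =
      ((2 * n + 1 : ℂ) ^ (3 * d))⁻¹ * ∑ l ∈ K d n, ∑ m ∈ K d n,
        (2 * n + 1 : ℂ) ^ d * (Bh l m * ω (2 * n + 1) (-(dotZ l p)) *
          ω (2 * n + 1) (-(dotZ m q)) * ω (2 * n + 1) (dotZ (l + m) r)) := by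
    simp only [Acoef]
    rw [← Finset.mul_sum, Finset.sum_comm]
    congr 1
    refine Finset.sum_congr rfl fun l hl => ?_
    rw [Finset.sum_comm]
    exact Finset.sum_congr rfl fun m hm => hinner l hl m hm
  rw [hswap]
  simp only [← Finset.mul_sum]
  have := natCast_pow_ne_zero d n
  rw [pow_mul']
  field_simp

theorem sum_Acoef_left {d n : ℕ} (Bh : (Fin d → ℤ) → (Fin d → ℤ) → ℂ) (r s : Fin d → ℤ) :
    ∑ p ∈ K d n, ∑ q ∈ K d n, Acoef d n Bh p q r s =
      ((2 * n + 1 : ℂ) ^ d)⁻¹ * ∑ m ∈ K d n,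
        Bh m m * ω (2 * n + 1) (dotZ m r) * ω (2 * n + 1) (-(dotZ m s)) := by
  set G : (Fin d → ℤ) → (Fin d → ℤ) → ℂ := fun l m => ∑ k ∈ K d n, ∑ j ∈ K d n,
    indN (2 * n + 1) (l + m - k - j) * Bh (smod n (l - j)) (smod n (m - j)) *
      ω (2 * n + 1) (dotZ k r) * ω (2 * n + 1) (dotZ j s) with hG
  have hA (p q : Fin d → ℤ) : Acoef d n Bh p q r s = ((2 * n + 1 : ℂ) ^ (3 * d))⁻¹ *
      ∑ l ∈ K d n, ω (2 * n + 1) (-(dotZ l p)) *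
        ∑ m ∈ K d n, ω (2 * n + 1) (-(dotZ m q)) * G l m := by
    simp only [Acoef, hG, Finset.mul_sum]
    refine Finset.sum_congr rfl fun l _ => Finset.sum_congr rfl fun m _ =>
      Finset.sum_congr rfl fun k _ => Finset.sum_congr rfl fun j _ => ?_
    ring
  have hcollapse (g : (Fin d → ℤ) → ℂ) :
      ∑ p ∈ K d n, ∑ l ∈ K d n, ω (2 * n + 1) (-(dotZ l p)) * g l =
        (2 * n + 1 : ℂ) ^ d * g 0 := by
    rw [Finset.sum_comm]
    simp only [← Finset.sum_mul, sum_K_ω_neg_dotZ, mul_assoc]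
    rw [← Finset.mul_sum, sum_K_indN]
  have hG0 : G 0 0 = ∑ m ∈ K d n,
      Bh m m * ω (2 * n + 1) (dotZ m r) * ω (2 * n + 1) (-(dotZ m s)) := by
    simp only [hG]
    rw [Finset.sum_comm]
    refine Finset.sum_nbij' (fun j => -j) (fun j => -j) (fun j => neg_mem_K) (fun j => neg_mem_K)
      (fun j _ => neg_neg j) (fun j _ => neg_neg j) fun j hj => ?_
    simp only [zero_sub, add_zero, smod_eq_self (neg_mem_K hj), mul_assoc, dotZ_neg, neg_neg,
      show ∀ k : Fin d → ℤ, -k - j = -j - k from fun k => by abel]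
    rw [sum_K_indN_sub, smod_eq_self (neg_mem_K hj), dotZ_neg]
  calc _ = ((2 * n + 1 : ℂ) ^ (3 * d))⁻¹ * ∑ p ∈ K d n, ∑ l ∈ K d n,
        ω (2 * n + 1) (-(dotZ l p)) *
          ∑ q ∈ K d n, ∑ m ∈ K d n, ω (2 * n + 1) (-(dotZ m q)) * G l m := by
        simp only [hA, ← Finset.mul_sum]
        congr 1
        refine Finset.sum_congr rfl fun p _ => ?_
        rw [Finset.sum_comm]
        simp only [← Finset.mul_sum]
    _ = _ := by
        rw [hcollapse, hcollapse, hG0]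
        have := natCast_pow_ne_zero d n
        rw [pow_mul']
        field_simp

/-- The Fourier collocation collision term can be written in discrete-velocity-method form. -/
theorem fcm_dvm_form (d n : ℕ) (hd : 1 ≤ d) (hn : 1 ≤ n)
    (Bh : (Fin d → ℤ) → (Fin d → ℤ) → ℂ)
    (hsym1 : ∀ l ∈ K d n, ∀ m ∈ K d n, Bh l m = Bh m l)
    (hsym2 : ∀ l ∈ K d n, ∀ m ∈ K d n, Bh l m = Bh l (-m))
    (F : (Fin d → ℤ) → ℂ) (r : Fin d → ℤ) (hr : r ∈ K d n) :
    ∑ l ∈ K d n, ∑ m ∈ K d n,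
        (Bh l m - Bh m m) * Fhat d n F l * Fhat d n F m * ω (2 * n + 1) (dotZ (l + m) r)
      = ∑ p ∈ K d n, ∑ q ∈ K d n, ∑ s ∈ K d n,
          Acoef d n Bh p q r s * (F p * F q - F r * F s) := by
  have hgain : ∑ l ∈ K d n, ∑ m ∈ K d n,
      Bh l m * Fhat d n F l * Fhat d n F m * ω (2 * n + 1) (dotZ (l + m) r) =
      ∑ p ∈ K d n, ∑ q ∈ K d n, (∑ s ∈ K d n, Acoef d n Bh p q r s) * (F p * F q) := by
    simp only [sum_Acoef_right, Fhat, Finset.mul_sum, Finset.sum_mul]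
    symm
    rw [Finset.sum_comm_cycle]
    refine Finset.sum_congr rfl fun l _ => ?_
    rw [Finset.sum_comm_cycle]
    refine Finset.sum_congr rfl fun m _ => ?_
    rw [Finset.sum_comm]
    refine Finset.sum_congr rfl fun q _ => Finset.sum_congr rfl fun p _ => ?_
    ring
  have hloss : ∑ l ∈ K d n, ∑ m ∈ K d n,
      Bh m m * Fhat d n F l * Fhat d n F m * ω (2 * n + 1) (dotZ (l + m) r) =
      ∑ s ∈ K d n, (∑ p ∈ K d n, ∑ q ∈ K d n, Acoef d n Bh p q r s) * (F r * F s) := by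
    calc _ = (∑ l ∈ K d n, Fhat d n F l * ω (2 * n + 1) (dotZ l r)) *
          ∑ m ∈ K d n, Bh m m * ω (2 * n + 1) (dotZ m r) * Fhat d n F m := by
          rw [Finset.sum_mul_sum]
          refine Finset.sum_congr rfl fun l _ => Finset.sum_congr rfl fun m _ => ?_
          rw [dotZ_add, ω_add]
          ring
      _ = _ := by
          rw [sum_Fhat_mul_ω F hr]
          simp only [sum_Acoef_left, Fhat, Finset.mul_sum, Finset.sum_mul]
          rw [Finset.sum_comm]
          refine Finset.sum_congr rfl fun s _ => Finset.sum_congr rfl fun m _ => ?_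
          ring
  simp only [sub_mul, mul_sub, Finset.sum_sub_distrib]
  rw [hgain, hloss]
  simp only [Finset.sum_mul]
  rw [Finset.sum_comm_cycle (f := fun p q s => Acoef d n Bh p q r s * (F r * F s))]
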